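/- Let C be a binary linear code of length n and let ≺ be a total order on F_2^n compatible with Hamming weight (i.e. w_H(a) < w_H(b) implies a ≺ b). Then the set L^1(C) is a test-set for C: for every y in F_2^n that is not a coset leader of C, there exists t in L^1(C) such that w_H(y + t) < w_H(y). -/

import Mathlib

/-- `w` is a coset leader of the binary code `C`: it has minimal Hamming weight
in its coset `w + C`. -/
def IsCosetLeader {n : ℕ} (C : Submodule (ZMod 2) (Fin n → ZMod 2))
    (w : Fin n → ZMod 2) : Prop :=
  ∀ v : Fin n → ZMod 2, w - v ∈ C → hammingNorm w ≤ hammingNorm v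

theorem hammingNorm_add_single_le {n : ℕ} (u : Fin n → ZMod 2) (i : Fin n) :
    hammingNorm (u + Pi.single i 1) ≤ hammingNorm u + 1 := by
  refine le_trans (Finset.card_le_card ?_)
    (Finset.card_insert_le i (Finset.univ.filter fun j => u j ≠ 0))
  intro j hj
  by_cases hji : j = i
  · simp [hji]
  · simpa [hji] using hj

theorem hammingNorm_add_single_lt {n : ℕ} {u : Fin n → ZMod 2} {i : Fin n} (hi : u i ≠ 0) :
    hammingNorm (u + Pi.single i 1) < hammingNorm u := by
  have hi1 : u i + 1 = 0 := (by decide : ∀ a : ZMod 2, a ≠ 0 → a + 1 = 0) _ hi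
  refine Finset.card_lt_card (Finset.ssubset_iff_of_subset ?_ |>.2 ⟨i, ?_, ?_⟩)
  · intro j hj
    by_cases hji : j = i
    · simpa [hji] using hi
    · simpa [hji] using hj
  · simpa using hi
  · simp [hi1]

theorem stmt_7 {n : ℕ} (C : Submodule (ZMod 2) (Fin n → ZMod 2))
    -- a total (strict) order on words compatible with the Hamming weight
    (lt : (Fin n → ZMod 2) → (Fin n → ZMod 2) → Prop)
    (hord : IsStrictTotalOrder (Fin n → ZMod 2) lt)
    (hcompat : ∀ a b : Fin n → ZMod 2, hammingNorm a < hammingNorm b → lt a b)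
    -- `Nf y` is the `lt`-minimum element of the coset `C + y`
    (Nf : (Fin n → ZMod 2) → (Fin n → ZMod 2))
    (hNmem : ∀ y : Fin n → ZMod 2, y - Nf y ∈ C)
    (hNmin : ∀ y v : Fin n → ZMod 2, y - v ∈ C → v = Nf y ∨ lt (Nf y) v)
    -- `L¹(C)` is a test-set
    (y : Fin n → ZMod 2) (hy : ¬ IsCosetLeader C y) :
    ∃ t ∈ {c : Fin n → ZMod 2 | c ∈ C ∧ c ≠ 0 ∧
        ∃ (n1 n2 : Fin n → ZMod 2) (i : Fin n),
          IsCosetLeader C n1 ∧ n2 ∈ Set.range Nf ∧ n1 i = 0 ∧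
          hammingNorm n2 < hammingNorm (n1 + Pi.single i 1) ∧
          c = n1 + n2 + Pi.single i 1},
      hammingNorm (y + t) < hammingNorm y := by
  have add_self (v : Fin n → ZMod 2) : v + v = 0 :=
    funext fun j => CharTwo.add_self_eq_zero (v j)
  induction hw : hammingNorm y using Nat.strong_induction_on generalizing y with
  | _ w ih =>
  subst hw
  by_cases h : ∃ i, y i ≠ 0 ∧ ¬ IsCosetLeader C (y + Pi.single i 1)
  · obtain ⟨i, hi, hlead⟩ := h
    have hlt := hammingNorm_add_single_lt hi
    obtain ⟨t, ht, hdec⟩ := ih _ hlt _ hlead rfl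
    refine ⟨t, ht, ?_⟩
    have hle := hammingNorm_add_single_le (y + Pi.single i 1 + t) i
    have heq : y + Pi.single i 1 + t + Pi.single i 1 = y + t := by
      rw [add_right_comm _ t, add_assoc y, add_self, add_zero]
    rw [heq] at hle
    omega
  · push Not at h
    have hdec : hammingNorm (Nf y) < hammingNorm y := by
      simp only [IsCosetLeader, not_forall, not_le] at hy
      obtain ⟨v, hv, hlt⟩ := hy
      refine lt_of_le_of_lt (not_lt.1 fun hvN => ?_) hlt
      rcases hNmin y v hv with rfl | hN
      · exact hvN.false
      · exact hord.irrefl _ (hord.trans _ _ _ hN (hcompat _ _ hvN))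
    have hsub : y - Nf y = y + Nf y := by
      rw [sub_eq_iff_eq_add, add_assoc, add_self, add_zero]
    have hy0 : y ≠ 0 := by
      rintro rfl
      simp at hdec
    obtain ⟨i, hi⟩ := Function.ne_iff.1 hy0
    refine ⟨y + Nf y, ⟨hsub ▸ hNmem y, ?_, y + Pi.single i 1, Nf y, i, h i hi, ⟨y, rfl⟩,
      ?_, ?_, ?_⟩, ?_⟩
    · rw [← hsub, sub_ne_zero]
      intro heq
      exact hdec.ne (congrArg hammingNorm heq.symm)
    · simpa using (by decide : ∀ a : ZMod 2, a ≠ 0 → a + 1 = 0) _ hi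
    · rwa [add_assoc, add_self, add_zero]
    · rw [add_right_comm _ (Nf y), add_assoc y, add_self, add_zero]
    · rwa [← add_assoc, add_self, zero_add]
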